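/- There exists a finite-dimensional solvable Leibniz algebra A (over a field of prime characteristic p) whose Frattini subalgebra F(A) is not an ideal of A. -/

import Mathlib

namespace Leib

variable {K : Type*} [Field K] {A : Type*} [AddCommGroup A] [Module K A]

variable (mul : A →ₗ[K] A →ₗ[K] A)

/-- The (left) Leibniz identity: left multiplication is a derivation. -/
def IsLeibniz : Prop :=
  ∀ x y z : A, mul x (mul y z) = mul (mul x y) z + mul y (mul x z)

/-- The product of two submodules: the span of all products. -/
def prodSM (B C : Submodule K A) : Submodule K A :=
  Submodule.span K {z | ∃ b ∈ B, ∃ c ∈ C, z = mul b c}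

/-- A subalgebra: a submodule closed under multiplication. -/
def IsSubalg (S : Submodule K A) : Prop :=
  ∀ x ∈ S, ∀ y ∈ S, mul x y ∈ S

/-- A (two-sided) ideal. -/
def IsIdeal (B : Submodule K A) : Prop :=
  ∀ a : A, ∀ b ∈ B, mul a b ∈ B ∧ mul b a ∈ B

/-- An abelian subspace: all products vanish. -/
def IsAbelian (B : Submodule K A) : Prop :=
  ∀ x ∈ B, ∀ y ∈ B, mul x y = 0

/-- A minimal ideal. -/
def IsMinIdeal (B : Submodule K A) : Prop :=
  IsIdeal mul B ∧ B ≠ ⊥ ∧ ∀ C : Submodule K A, IsIdeal mul C → C ≤ B → C = ⊥ ∨ C = B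

/-- Lower central series of a subalgebra `B`: `B, B·B, B·(B·B), ...`. -/
def lcsOf (B : Submodule K A) : ℕ → Submodule K A
  | 0 => B
  | n + 1 => prodSM mul B (lcsOf B n)

/-- A nilpotent subalgebra. -/
def IsNilpotentSubalg (B : Submodule K A) : Prop := ∃ n, lcsOf mul B n = ⊥

/-- A nilpotent algebra. -/
def IsNilpotentAlg : Prop := ∃ n, lcsOf mul ⊤ n = ⊥

/-- Derived series of a subalgebra. -/
def derOf (B : Submodule K A) : ℕ → Submodule K A
  | 0 => B
  | n + 1 => prodSM mul (derOf B n) (derOf B n)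

/-- A solvable subalgebra. -/
def IsSolvableSubalg (B : Submodule K A) : Prop := ∃ n, derOf mul B n = ⊥

/-- A solvable algebra. -/
def IsSolvableAlg : Prop := ∃ n, derOf mul ⊤ n = ⊥

/-- A semisimple algebra: no nonzero solvable ideal. -/
def IsSemisimpleAlg : Prop :=
  ∀ B : Submodule K A, IsIdeal mul B → IsSolvableSubalg mul B → B = ⊥

/-- The nilradical: the largest nilpotent ideal (here: the sup of all nilpotent ideals). -/
def nilrad : Submodule K A :=
  sSup {B : Submodule K A | IsIdeal mul B ∧ IsNilpotentSubalg mul B}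

/-- The socle: the sum of all minimal ideals. -/
def socle : Submodule K A := sSup {B : Submodule K A | IsMinIdeal mul B}

/-- The abelian socle: the sum of all abelian minimal ideals. -/
def asocle : Submodule K A :=
  sSup {B : Submodule K A | IsMinIdeal mul B ∧ IsAbelian mul B}

/-- The centralizer of a subspace `W`: elements annihilating `W` on both sides. -/
def centralizer (W : Submodule K A) : Submodule K A where
  carrier := {x | ∀ w ∈ W, mul x w = 0 ∧ mul w x = 0}
  add_mem' := by
    intro a b ha hb w hw
    constructor
    · simp [map_add, (ha w hw).1, (hb w hw).1]
    · simp [map_add, (ha w hw).2, (hb w hw).2]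
  zero_mem' := by intro w hw; simp
  smul_mem' := by
    intro c a ha w hw
    constructor
    · simp [map_smul, (ha w hw).1]
    · simp [map_smul, (ha w hw).2]

/-- The center of the algebra. -/
def center : Submodule K A := centralizer mul ⊤

/-- A maximal (proper) subalgebra of a subalgebra `M`. -/
def IsMaxSubalgIn (M S : Submodule K A) : Prop :=
  S ≤ M ∧ IsSubalg mul S ∧ S ≠ M ∧
    ∀ T : Submodule K A, T ≤ M → IsSubalg mul T → S ≤ T → T = S ∨ T = M

/-- The Frattini subalgebra of `M`: the intersection of its maximal subalgebras
(equal to `M` if there are none). -/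
def frattiniSubalgIn (M : Submodule K A) : Submodule K A :=
  M ⊓ sInf {S : Submodule K A | IsMaxSubalgIn mul M S}

/-- An ideal of the subalgebra `M`. -/
def IsIdealIn (M C : Submodule K A) : Prop :=
  C ≤ M ∧ ∀ x ∈ M, ∀ c ∈ C, mul x c ∈ C ∧ mul c x ∈ C

/-- The Frattini ideal of `M`: the largest ideal of `M` contained in its
Frattini subalgebra. -/
def frattiniIdealIn (M : Submodule K A) : Submodule K A :=
  sSup {C : Submodule K A | IsIdealIn mul M C ∧ C ≤ frattiniSubalgIn mul M}

/-- The Frattini subalgebra of the algebra. -/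
def frattiniSubalg : Submodule K A := frattiniSubalgIn mul ⊤

/-- The Frattini ideal of the algebra. -/
def frattiniIdeal : Submodule K A := frattiniIdealIn mul ⊤

/-- An elementary algebra: every subalgebra has zero Frattini ideal. -/
def IsElementary : Prop :=
  ∀ M : Submodule K A, IsSubalg mul M → frattiniIdealIn mul M = ⊥

/-- The derived subalgebra `A² = A·A`. -/
def derivedSubalg : Submodule K A := prodSM mul ⊤ ⊤

/-- A Cartan subalgebra: a nilpotent, self-normalizing subalgebra. -/
def IsCartan (H : Submodule K A) : Prop :=
  IsSubalg mul H ∧ IsNilpotentSubalg mul H ∧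
    ∀ x : A, (∀ h ∈ H, mul x h ∈ H ∧ mul h x ∈ H) → x ∈ H

end Leib

open Leib

variable {K : Type*} [Field K] {A : Type*} [AddCommGroup A] [Module K A]
variable (mul : A →ₗ[K] A →ₗ[K] A)

/-- A finite-dimensional solvable Leibniz algebra over a field of prime
characteristic whose Frattini subalgebra is not an ideal. -/
structure FrattiniNotIdealExample where
  p : ℕ
  hp : p.Prime
  K : Type
  [fieldK : Field K]
  charK : CharP K p
  A : Type
  [acgA : AddCommGroup A]
  [modA : Module K A]
  mul : A →ₗ[K] A →ₗ[K] A
  hleib : Leib.IsLeibniz mul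
  findim : FiniteDimensional K A
  solvable : Leib.IsSolvableAlg mul
  notIdeal : ¬ Leib.IsIdeal mul (Leib.frattiniSubalg mul)

namespace Leib

theorem prodSM_le {K A : Type*} [Field K] [AddCommGroup A] [Module K A]
    {mul : A →ₗ[K] A →ₗ[K] A} {B C D : Submodule K A}
    (h : ∀ b ∈ B, ∀ c ∈ C, mul b c ∈ D) : prodSM mul B C ≤ D := by
  refine Submodule.span_le.2 ?_
  rintro _ ⟨b, hb, c, hc, rfl⟩
  exact h b hb c hc

namespace HeisenbergExample

/-- The space with basis `x, y, z, e₀, e₁` over the field with two elements. -/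
abbrev Carrier : Type := Fin 5 → ZMod 2

/-- The semidirect product of the Heisenberg algebra `⟨x, y, z⟩` with its module `⟨e₀, e₁⟩`,
in characteristic two, with the right action on the module equal to zero. -/
def product : Carrier →ₗ[ZMod 2] Carrier →ₗ[ZMod 2] Carrier :=
  LinearMap.mk₂ (ZMod 2)
    (fun a b => ![0, 0, a 1 * b 0 - a 0 * b 1, a 2 * b 3 + a 0 * b 4,
      a 2 * b 4 + a 0 * b 3 + a 1 * b 3])
    (by intros; ext i; fin_cases i <;> simp <;> ring)
    (by intros; ext i; fin_cases i <;> simp <;> ring)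
    (by intros; ext i; fin_cases i <;> simp <;> ring)
    (by intros; ext i; fin_cases i <;> simp <;> ring)

theorem product_apply (a b : Carrier) :
    product a b = ![0, 0, a 1 * b 0 - a 0 * b 1, a 2 * b 3 + a 0 * b 4,
      a 2 * b 4 + a 0 * b 3 + a 1 * b 3] := rfl

theorem isLeibniz_product : IsLeibniz product := by
  intro a b c
  ext i
  fin_cases i <;> simp [product_apply] <;> grind

/-- The vectors whose first `n` coordinates vanish. -/
def tail (n : ℕ) : Submodule (ZMod 2) Carrier where
  carrier := {a | ∀ i : Fin 5, i.val < n → a i = 0}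
  add_mem' ha hb i hi := by simp [ha i hi, hb i hi]
  zero_mem' _ _ := rfl
  smul_mem' c a ha i hi := by simp [ha i hi]

theorem mem_tail {n : ℕ} {a : Carrier} :
    a ∈ tail n ↔ ∀ i : Fin 5, i.val < n → a i = 0 := Iff.rfl

theorem isSolvableAlg_product : IsSolvableAlg product := by
  have h1 : derOf product ⊤ 1 ≤ tail 2 :=
    prodSM_le fun a _ b _ => by simp [mem_tail, Fin.forall_fin_succ, product_apply]
  have h2 : derOf product ⊤ 2 ≤ tail 3 := prodSM_le fun a ha b hb => by
    have ha := h1 ha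
    have hb := h1 hb
    simp_all [mem_tail, Fin.forall_fin_succ, product_apply]
  refine ⟨3, le_bot_iff.1 (prodSM_le fun a ha b hb => ?_)⟩
  have ha := h2 ha
  have hb := h2 hb
  rw [Submodule.mem_bot]
  ext i
  fin_cases i <;> simp_all [mem_tail, Fin.forall_fin_succ, product_apply]

/-- The Heisenberg subalgebra. -/
def heisenberg : Submodule (ZMod 2) Carrier where
  carrier := {a | a 3 = 0 ∧ a 4 = 0}
  add_mem' ha hb := by simp [ha.1, ha.2, hb.1, hb.2]
  zero_mem' := ⟨rfl, rfl⟩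
  smul_mem' c a ha := by simp [ha.1, ha.2]

theorem mem_heisenberg {a : Carrier} : a ∈ heisenberg ↔ a 3 = 0 ∧ a 4 = 0 := Iff.rfl

theorem isMaxSubalgIn_heisenberg : IsMaxSubalgIn product ⊤ heisenberg := by
  refine ⟨le_top, fun a ha b hb => ?_, fun h => ?_, fun T _ hT hHT => ?_⟩
  · rw [mem_heisenberg] at *
    simp [product_apply, hb]
  · have : (![0, 0, 0, 1, 0] : Carrier) ∈ heisenberg := h ▸ Submodule.mem_top
    simp [mem_heisenberg] at this
  refine or_iff_not_imp_left.2 fun hne => ?_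
  have hx : (![1, 0, 0, 0, 0] : Carrier) ∈ T := hHT ⟨rfl, rfl⟩
  have hy : (![0, 1, 0, 0, 0] : Carrier) ∈ T := hHT ⟨rfl, rfl⟩
  obtain ⟨t, htT, htH⟩ := SetLike.exists_of_lt (lt_of_le_of_ne hHT (Ne.symm hne))
  have hv : (![0, 0, 0, t 3, t 4] : Carrier) ∈ T := by
    have := T.sub_mem htT (hHT (show ![t 0, t 1, t 2, 0, 0] ∈ heisenberg from ⟨rfl, rfl⟩))
    convert this using 1
    ext i
    fin_cases i <;> simp
  have hxv := hT _ hx _ hv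
  have hyv := hT _ hy _ hv
  have hyxv := hT _ hy _ hxv
  have hxyv := hT _ hx _ hyv
  rw [mem_heisenberg] at htH
  generalize t 3 = r at *
  generalize t 4 = s at *
  simp only [product_apply] at hxv hyv hyxv hxyv
  have zero_or_one : ∀ c : ZMod 2, c = 0 ∨ c = 1 := by decide
  have h01 : (![0, 0, 0, 1, 0] : Carrier) ∈ T ∧ (![0, 0, 0, 0, 1] : Carrier) ∈ T := by
    rcases zero_or_one r with rfl | rfl <;> rcases zero_or_one s with rfl | rfl <;> simp_all
  refine eq_top_iff.2 fun a _ => ?_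
  have := T.add_mem (hHT (show ![a 0, a 1, a 2, 0, 0] ∈ heisenberg from ⟨rfl, rfl⟩))
    (T.add_mem (T.smul_mem (a 3) h01.1) (T.smul_mem (a 4) h01.2))
  convert this using 1
  ext i
  fin_cases i <;> simp

/-- The central element `z` of the Heisenberg algebra lies in every maximal subalgebra. -/
theorem z_mem_of_isMaxSubalgIn {S : Submodule (ZMod 2) Carrier}
    (hS : IsMaxSubalgIn product ⊤ S) : (![0, 0, 1, 0, 0] : Carrier) ∈ S := by
  obtain ⟨-, hmul, -, hmax⟩ := hS
  have hV : ∀ a, ∀ v ∈ tail 3, product a v ∈ tail 3 ∧ product v a = 0 := by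
    intro a v hv
    simp_all [funext_iff, mem_tail, Fin.forall_fin_succ, product_apply]
  have hSV : IsSubalg product (S ⊔ tail 3) := by
    intro a ha b hb
    obtain ⟨s, hs, v, hv, rfl⟩ := Submodule.mem_sup.1 ha
    obtain ⟨t, ht, w, hw, rfl⟩ := Submodule.mem_sup.1 hb
    rw [map_add, LinearMap.map_add₂, (hV _ v hv).2, add_zero]
    exact Submodule.add_mem_sup (hmul _ hs _ ht) (hV _ _ hw).1
  rcases hmax _ le_top hSV le_sup_left with h | h
  · have hVS : tail 3 ≤ S := h ▸ le_sup_right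
    have hSz : IsSubalg product (S ⊔ Submodule.span (ZMod 2) {![0, 0, 1, 0, 0]}) := by
      intro a ha b hb
      obtain ⟨s, hs, v, hv, rfl⟩ := Submodule.mem_sup.1 ha
      obtain ⟨t, ht, w, hw, rfl⟩ := Submodule.mem_sup.1 hb
      obtain ⟨c, rfl⟩ := Submodule.mem_span_singleton.1 hv
      obtain ⟨d, rfl⟩ := Submodule.mem_span_singleton.1 hw
      refine Submodule.mem_sup_left ?_
      have := S.add_mem (hmul _ hs _ ht)
        (hVS (show ![0, 0, 0, c * t 3, c * t 4] ∈ tail 3 by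
          simp [mem_tail, Fin.forall_fin_succ]))
      convert this using 1
      ext i
      fin_cases i <;> simp [product_apply, Matrix.vecHead, Matrix.vecTail] <;> ring
    rcases hmax _ le_top hSz le_sup_left with h | h
    · rw [← h]
      exact Submodule.mem_sup_right (Submodule.mem_span_singleton_self _)
    · obtain ⟨s, hs, v, hv, hsv⟩ := Submodule.mem_sup.1
        (h ▸ Submodule.mem_top : (![0, 1, 0, 0, 0] : Carrier) ∈ S ⊔ _)
      obtain ⟨t, ht, w, hw, htw⟩ := Submodule.mem_sup.1
        (h ▸ Submodule.mem_top : (![1, 0, 0, 0, 0] : Carrier) ∈ S ⊔ _)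
      obtain ⟨c, rfl⟩ := Submodule.mem_span_singleton.1 hv
      obtain ⟨d, rfl⟩ := Submodule.mem_span_singleton.1 hw
      obtain rfl := eq_sub_of_add_eq hsv
      obtain rfl := eq_sub_of_add_eq htw
      convert hmul _ hs _ ht using 1
      ext i
      fin_cases i <;> simp [product_apply]
  · obtain ⟨s, hs, v, hv, hsv⟩ := Submodule.mem_sup.1
      (h ▸ Submodule.mem_top : (![0, 0, 1, 0, 0] : Carrier) ∈ S ⊔ tail 3)
    obtain rfl := eq_sub_of_add_eq hsv
    have hvS : v ∈ S := by
      convert S.neg_mem (hmul _ hs _ hs) using 1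
      rw [mem_tail] at hv
      simp [Fin.forall_fin_succ] at hv
      ext i
      fin_cases i <;> simp [product_apply, hv, Matrix.vecHead, Matrix.vecTail]
    exact (Submodule.sub_mem_iff_left S hvS).1 hs

theorem not_isIdeal_frattiniSubalg : ¬ IsIdeal product (frattiniSubalg product) := by
  intro h
  have hz : (![0, 0, 1, 0, 0] : Carrier) ∈ frattiniSubalg product :=
    ⟨Submodule.mem_top, Submodule.mem_sInf.2 fun _ => z_mem_of_isMaxSubalgIn⟩
  have he := Submodule.mem_sInf.1 (h ![0, 0, 0, 1, 0] _ hz).2.2 _ isMaxSubalgIn_heisenberg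
  simp [mem_heisenberg, product_apply] at he

end HeisenbergExample

end Leib

/-- There exists a finite-dimensional solvable Leibniz algebra over a field of
prime characteristic whose Frattini subalgebra is not an ideal. -/
theorem stmt13 : Nonempty FrattiniNotIdealExample := by
  exact ⟨{
    p := 2
    hp := Nat.prime_two
    K := ZMod 2
    charK := inferInstance
    A := HeisenbergExample.Carrier
    mul := HeisenbergExample.product
    hleib := HeisenbergExample.isLeibniz_product
    findim := inferInstance
    solvable := HeisenbergExample.isSolvableAlg_product
    notIdeal := HeisenbergExample.not_isIdeal_frattiniSubalg }⟩
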